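/- Let R be a commutative ring with unity that satisfies the radical formula and let A be an R-module such that every R-module homomorphism from A into every reduced R-module is zero. Then A is a nil R-module. (Together with its companion statements this says that the class of nil R-modules is the torsion class and the class of reduced R-modules is the torsion-free class of a torsion theory.) -/

import Mathlib

open Submodule

universe u v

/-- The envelope `E_M(N)` of a submodule `N` of `M`:
the set of elements `a • m` with `a ^ k • m ∈ N` for some positive integer `k`. -/
def envSet {R : Type u} [CommRing R] {M : Type v} [AddCommGroup M] [Module R M]
    (N : Submodule R M) : Set M :=
  {x | ∃ (a : R) (m : M) (k : ℕ), 0 < k ∧ a ^ k • m ∈ N ∧ x = a • m}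

/-- The submodule `⟨E_M(N)⟩` generated by the envelope of `N`. -/
def envSub {R : Type u} [CommRing R] {M : Type v} [AddCommGroup M] [Module R M]
    (N : Submodule R M) : Submodule R M :=
  Submodule.span R (envSet N)

/-- `chainSub N n = ⟨E_n(N)⟩`: the ascending chain with `⟨E_0(N)⟩ = N` and
`⟨E_{n+1}(N)⟩ = ⟨E_M(⟨E_n(N)⟩)⟩`. -/
def chainSub {R : Type u} [CommRing R] {M : Type v} [AddCommGroup M] [Module R M]
    (N : Submodule R M) : ℕ → Submodule R M
  | 0 => N
  | n + 1 => envSub (chainSub N n)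

/-- A proper submodule `K` is semiprime if `a ^ 2 • m ∈ K` implies `a • m ∈ K`. -/
def IsSemiprimeSub {R : Type u} [CommRing R] {M : Type v} [AddCommGroup M] [Module R M]
    (K : Submodule R M) : Prop :=
  K ≠ ⊤ ∧ ∀ (a : R) (m : M), a ^ 2 • m ∈ K → a • m ∈ K

/-- The semiprime radical `S(N)`: the intersection of all semiprime submodules containing `N`. -/
def spRadical {R : Type u} [CommRing R] {M : Type v} [AddCommGroup M] [Module R M]
    (N : Submodule R M) : Submodule R M :=
  sInf {K | IsSemiprimeSub K ∧ N ≤ K}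

/-- A proper submodule `P` is prime if `a • m ∈ P` implies `m ∈ P` or `a • M ⊆ P`. -/
def IsPrimeSub {R : Type u} [CommRing R] {M : Type v} [AddCommGroup M] [Module R M]
    (P : Submodule R M) : Prop :=
  P ≠ ⊤ ∧ ∀ (a : R) (m : M), a • m ∈ P → m ∈ P ∨ ∀ x : M, a • x ∈ P

/-- The prime radical `β(N)`: the intersection of all prime submodules containing `N`. -/
def primeRadical {R : Type u} [CommRing R] {M : Type v} [AddCommGroup M] [Module R M]
    (N : Submodule R M) : Submodule R M :=
  sInf {P | IsPrimeSub P ∧ N ≤ P}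

/-- `Γ_a(M) = {m : a ^ k • m = 0 for some positive integer k}`. -/
def Gamma {R : Type u} [CommRing R] {M : Type v} [AddCommGroup M] [Module R M]
    (a : R) : Submodule R M where
  carrier := {m | ∃ k : ℕ, 0 < k ∧ a ^ k • m = 0}
  zero_mem' := ⟨1, one_pos, smul_zero _⟩
  add_mem' := by
    rintro x y ⟨k, hk, hx⟩ ⟨l, hl, hy⟩
    refine ⟨k + l, by omega, ?_⟩
    have h1 : a ^ (k + l) • x = 0 := by rw [pow_add, mul_comm, mul_smul, hx, smul_zero]
    have h2 : a ^ (k + l) • y = 0 := by rw [pow_add, mul_smul, hy, smul_zero]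
    rw [smul_add, h1, h2, add_zero]
  smul_mem' := by
    rintro c x ⟨k, hk, hx⟩
    exact ⟨k, hk, by rw [smul_comm, hx, smul_zero]⟩

/-- `aΓ_a(M)`: the image of `Γ_a(M)` under multiplication by `a`. -/
def aGamma {R : Type u} [CommRing R] {M : Type v} [AddCommGroup M] [Module R M]
    (a : R) : Submodule R M :=
  (Gamma (M := M) a).map (LinearMap.lsmul R M a)

/-- An element `m` of an `R`-module is nilpotent if `m = Σ_{i=1}^r a_i • m_i` with
`a_i ^ k • m_i = 0` for all `i`, for some positive integers `r`, `k`. -/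
def IsNilpotentElem (R : Type u) [CommRing R] {M : Type v} [AddCommGroup M] [Module R M]
    (m : M) : Prop :=
  ∃ (r : ℕ) (a : Fin r → R) (x : Fin r → M) (k : ℕ),
    0 < r ∧ 0 < k ∧ m = ∑ i, a i • x i ∧ ∀ i, (a i) ^ k • x i = 0

/-- A reduced module: `a ^ k • m = 0` (for some positive `k`) implies `a • m = 0`,
i.e. `E_M(0) = 0`. -/
def IsReducedModule (R : Type u) [CommRing R] (M : Type v) [AddCommGroup M] [Module R M] : Prop :=
  ∀ (a : R) (m : M) (k : ℕ), 0 < k → a ^ k • m = 0 → a • m = 0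

theorem IsPrimeSub.smul_mem_of_pow_smul_mem {R : Type u} [CommRing R] {M : Type v}
    [AddCommGroup M] [Module R M] {P : Submodule R M} (hP : IsPrimeSub P) {a : R} {m : M} :
    ∀ {k : ℕ}, a ^ k • m ∈ P → a • m ∈ P
  | 0, h => P.smul_mem a (by simpa using h)
  | k + 1, h => by
    rw [pow_succ', mul_smul] at h
    rcases hP.2 a _ h with h | h
    · exact hP.smul_mem_of_pow_smul_mem h
    · exact h m

/-- The quotient of a module by a prime radical is reduced. -/
theorem isReducedModule_quotient_primeRadical {R : Type u} [CommRing R] {M : Type v}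
    [AddCommGroup M] [Module R M] (N : Submodule R M) :
    IsReducedModule R (M ⧸ primeRadical N) := by
  intro a x k _ h
  obtain ⟨m, rfl⟩ := Submodule.Quotient.mk_surjective _ x
  rw [← Submodule.Quotient.mk_smul, Submodule.Quotient.mk_eq_zero] at h ⊢
  rw [primeRadical, Submodule.mem_sInf] at h ⊢
  exact fun P hP => hP.1.smul_mem_of_pow_smul_mem (h P hP)

theorem IsNilpotentElem.add {R : Type u} [CommRing R] {M : Type v} [AddCommGroup M]
    [Module R M] {x y : M} (hx : IsNilpotentElem R x) (hy : IsNilpotentElem R y) :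
    IsNilpotentElem R (x + y) := by
  obtain ⟨r, a, u, k, hr, hk, rfl, hu⟩ := hx
  obtain ⟨s, b, w, l, -, -, rfl, hw⟩ := hy
  refine ⟨r + s, Fin.append a b, Fin.append u w, k + l, by omega, by omega, ?_, ?_⟩
  · simp [Fin.sum_univ_add]
  · intro i
    refine Fin.addCases (fun i => ?_) (fun i => ?_) i
    · simp [pow_add, mul_comm (a i ^ k), mul_smul, hu]
    · simp [pow_add, mul_smul, hw]

theorem IsNilpotentElem.smul {R : Type u} [CommRing R] {M : Type v} [AddCommGroup M]
    [Module R M] {x : M} (c : R) (hx : IsNilpotentElem R x) : IsNilpotentElem R (c • x) := by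
  obtain ⟨r, a, u, k, hr, hk, rfl, hu⟩ := hx
  refine ⟨r, a, fun i => c • u i, k, hr, hk, ?_, fun i => ?_⟩
  · rw [Finset.smul_sum]
    exact Finset.sum_congr rfl fun i _ => smul_comm _ _ _
  · rw [smul_comm, hu, smul_zero]

/-- Every element of the submodule generated by the envelope of zero is nilpotent. -/
theorem isNilpotentElem_of_mem_envSub_bot {R : Type u} [CommRing R] {M : Type v}
    [AddCommGroup M] [Module R M] {x : M} (hx : x ∈ envSub (⊥ : Submodule R M)) :
    IsNilpotentElem R x := by
  refine Submodule.span_induction ?_ ?_ (fun _ _ _ _ => IsNilpotentElem.add)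
    (fun c _ _ => IsNilpotentElem.smul c) hx
  · rintro _ ⟨a, m, k, hk, hm, rfl⟩
    exact ⟨1, fun _ => a, fun _ => m, k, one_pos, hk, by simp, fun _ => by simpa using hm⟩
  · exact ⟨1, 0, 0, 1, one_pos, one_pos, by simp, by simp⟩

/-- If `R` satisfies the radical formula and `A` is an `R`-module such that
every homomorphism from `A` into every reduced `R`-module is zero, then `A` is nil. -/
theorem stmt15 {R : Type u} [CommRing R]
    (hRF : ∀ (P : Type v) [AddCommGroup P] [Module R P] (N : Submodule R P),
      envSub N = primeRadical N)
    (A : Type v) [AddCommGroup A] [Module R A]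
    (hA : ∀ (F : Type v) [AddCommGroup F] [Module R F], IsReducedModule R F →
      ∀ γ : A →ₗ[R] F, γ = 0) :
    ∀ m : A, IsNilpotentElem R m := by
  intro m
  apply isNilpotentElem_of_mem_envSub_bot
  rw [hRF A ⊥, ← Submodule.Quotient.mk_eq_zero]
  exact LinearMap.congr_fun
    (hA _ (isReducedModule_quotient_primeRadical ⊥) (primeRadical ⊥).mkQ) m
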